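/- (Necessity part of the equality case of von Neumann's inequality for tensors.) Let X, Y be order-D real tensors of the same size such that ⟨X, Y⟩ = ∑_{k=1}^{n d} σ^(d)_k(X) · σ^(d)_k(Y) for every mode d = 1,…,D. Then there exist orthogonal matrices W^(d) ∈ ℝ^{n_d × n_d} for d = 1,…,D, a number of blocks L, and tensors D_X, D_Y of the same size as X, Y such that: X = D_X ×_1 W^(1) ⋯ ×_D W^(D); Y = D_Y ×_1 W^(1) ⋯ ×_D W^(D); D_X and D_Y are block-wise diagonal with the same L blocks (i.e., with the same block-assignment functions β_d); and for each l = 1,…,L the l-th blocks are proportional: there exists ρ_l such that either the l-th block of D_X equals ρ_l times the l-th block of D_Y, or the l-th block of D_Y equals ρ_l times the l-th block of D_X. -/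

import Mathlib

open scoped BigOperators Matrix

/-- The entries of `v` sorted in nonincreasing order. -/
noncomputable def sortDesc {m : ℕ} (v : Fin m → ℝ) : Fin m → ℝ :=
  fun k => (v ∘ Tuple.sort v) k.rev

theorem gram_isHermitian {m : ℕ} {J : Type*} [Fintype J]
    (A : Matrix (Fin m) J ℝ) : (A * Aᵀ).IsHermitian := by
  ext i j
  simp [Matrix.conjTranspose_apply, Matrix.mul_apply, Matrix.transpose_apply, mul_comm]

/-- Singular values of a real matrix `A`: the square roots of the eigenvalues of
the positive semidefinite matrix `A * Aᵀ`, in nonincreasing order. -/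
noncomputable def singularValues {m : ℕ} {J : Type*} [Fintype J]
    (A : Matrix (Fin m) J ℝ) : Fin m → ℝ :=
  fun k => Real.sqrt (sortDesc (gram_isHermitian A).eigenvalues k)

variable {D : ℕ} {n : Fin D → ℕ}

/-- Inner product of two tensors. -/
noncomputable def tinner (X Y : (∀ d, Fin (n d)) → ℝ) : ℝ :=
  ∑ i : ∀ d, Fin (n d), X i * Y i

/-- Mode-`d` matricization of the tensor `X`. -/
def matricize (X : (∀ d, Fin (n d)) → ℝ) (d : Fin D) :
    Matrix (Fin (n d)) (∀ d' : {d' : Fin D // d' ≠ d}, Fin (n d')) ℝ :=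
  Matrix.of fun k j =>
    X (fun d' => if h : d' = d then Fin.cast (congrArg n h.symm) k else j ⟨d', h⟩)

/-- Mode-`d` singular values of a tensor. -/
noncomputable def modeSV (X : (∀ d, Fin (n d)) → ℝ) (d : Fin D) : Fin (n d) → ℝ :=
  singularValues (matricize X d)

/-- The multilinear (Tucker) product `X ×₁ U 1 ×₂ ⋯ ×_D U D`. -/
noncomputable def tuckerMul (X : (∀ d, Fin (n d)) → ℝ)
    (U : ∀ d, Matrix (Fin (n d)) (Fin (n d)) ℝ) : (∀ d, Fin (n d)) → ℝ :=
  fun i => ∑ j : ∀ d, Fin (n d), (∏ d, U d (i d) (j d)) * X j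

/-- Rectangular "diagonal" matrix with columns indexed by an arbitrary fintype,
identified with an initial segment of `ℕ` via `Fintype.equivFin`. -/
noncomputable def rectDiagJ {m : ℕ} {J : Type*} [Fintype J]
    (v : Fin m → ℝ) : Matrix (Fin m) J ℝ :=
  Matrix.of fun k j => if ((Fintype.equivFin J) j : ℕ) = (k : ℕ) then v k else 0

/-- Discrete Riemann sums of a nonincreasing function against a nonincreasing integrator compare
with the increment weighted by the right endpoint. -/
theorem sub_mul_le_sub_of_antitone {a b g : ℕ → ℝ} (ha : Antitone a) (hb : Antitone b)
    (hg : ∀ k, g k - g (k + 1) = (a k - a (k + 1)) * b k) (k l : ℕ) :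
    (a k - a l) * b l ≤ g k - g l := by
  rcases le_total k l with h | h
  · induction l, h using Nat.le_induction with
    | base => simp
    | succ l hl ih =>
      nlinarith [hg l, hb (Nat.le_succ l), ha hl, ha (Nat.le_succ l)]
  · induction k, h using Nat.le_induction with
    | base => simp
    | succ k hk ih =>
      nlinarith [hg k, hb hk, ha (Nat.le_succ k)]

/-- Optimal dual potentials for the assignment problem with cost `a k * b l`. -/
theorem exists_dual_potentials {m : ℕ} {a b : Fin m → ℝ} (ha : Antitone a) (hb : Antitone b)
    (ha0 : ∀ k, 0 ≤ a k) (hb0 : ∀ k, 0 ≤ b k) :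
    ∃ p q : Fin m → ℝ, (∀ k, 0 ≤ p k) ∧ (∀ k, 0 ≤ q k) ∧
      (∀ k l, a k * b l ≤ p k + q l) ∧ ∀ k, p k + q k = a k * b k := by
  have ext_anti : ∀ c : Fin m → ℝ, Antitone c → (∀ k, 0 ≤ c k) →
      Antitone (fun j : ℕ => if h : j < m then c ⟨j, h⟩ else 0) := by
    intro c hc hc0 i j hij
    by_cases hj : j < m
    · have hi : i < m := lt_of_le_of_lt hij hj
      simpa [hi, hj] using hc (show (⟨i, hi⟩ : Fin m) ≤ ⟨j, hj⟩ from hij)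
    · by_cases hi : i < m <;> simp [hi, hj, hc0]
  set A : ℕ → ℝ := fun j => if h : j < m then a ⟨j, h⟩ else 0 with hA
  set B : ℕ → ℝ := fun j => if h : j < m then b ⟨j, h⟩ else 0 with hB
  have hAa : ∀ k : Fin m, A k = a k := fun k => by simp [hA]
  have hBb : ∀ k : Fin m, B k = b k := fun k => by simp [hB]
  have hAm : A m = 0 := by simp [hA]
  have hBm : B m = 0 := by simp [hB]
  set g : ℕ → ℝ := fun k => -∑ j ∈ Finset.range k, (A j - A (j + 1)) * B j with hg
  have key := sub_mul_le_sub_of_antitone (g := g) (ext_anti a ha ha0) (ext_anti b hb hb0)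
    (fun k => by simp only [hg, Finset.sum_range_succ]; ring)
  refine ⟨fun k => g k - g m, fun k => a k * b k - (g k - g m), fun k => ?_, fun k => ?_,
    fun k l => ?_, fun k => by ring⟩
  · have := key k m
    change (A k - A m) * B m ≤ g k - g m at this
    rw [hBm] at this
    linarith
  · have := key m k
    change (A m - A k) * B k ≤ g m - g k at this
    rw [hAm, hAa, hBb] at this
    linarith
  · have := key k l
    change (A k - A l) * B l ≤ g k - g l at this
    rw [hAa, hAa, hBb] at this
    linarith

/-- Rearrangement inequality for doubly substochastic matrices. -/
theorem sum_mul_mul_le_of_substochastic {m : ℕ} {a b : Fin m → ℝ} (ha : Antitone a)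
    (hb : Antitone b) (ha0 : ∀ k, 0 ≤ a k) (hb0 : ∀ k, 0 ≤ b k) {M : Matrix (Fin m) (Fin m) ℝ}
    (hM : ∀ k l, 0 ≤ M k l) (hrow : ∀ k, ∑ l, M k l ≤ 1) (hcol : ∀ l, ∑ k, M k l ≤ 1) :
    ∑ k, ∑ l, a k * b l * M k l ≤ ∑ k, a k * b k := by
  obtain ⟨p, q, hp, hq, hpq, hd⟩ := exists_dual_potentials ha hb ha0 hb0
  calc ∑ k, ∑ l, a k * b l * M k l ≤ ∑ k, ∑ l, (p k * M k l + q l * M k l) := by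
        gcongr with k _ l _
        rw [← add_mul]
        exact mul_le_mul_of_nonneg_right (hpq k l) (hM k l)
    _ = ∑ k, p k * ∑ l, M k l + ∑ l, q l * ∑ k, M k l := by
        simp only [Finset.sum_add_distrib, Finset.mul_sum]
        rw [Finset.sum_comm (f := fun k l => q l * M k l)]
    _ ≤ ∑ k, p k + ∑ l, q l := by
        gcongr with k _ l _
        · exact mul_le_of_le_one_right (hp k) (hrow k)
        · exact mul_le_of_le_one_right (hq l) (hcol l)
    _ = ∑ k, a k * b k := by
        rw [← Finset.sum_add_distrib]
        exact Finset.sum_congr rfl fun k _ => hd k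

/-- Bessel's inequality for a matrix whose rows are orthogonal of norm at most one. -/
theorem dotProduct_mulVec_self_le {ι J : Type*} [Fintype ι] [DecidableEq ι] [Fintype J]
    {S : Matrix ι J ℝ} {e : ι → ℝ} (hS : S * Sᵀ = Matrix.diagonal e) (he : ∀ k, e k ≤ 1)
    (v : J → ℝ) : (S *ᵥ v) ⬝ᵥ (S *ᵥ v) ≤ v ⬝ᵥ v := by
  set c := S *ᵥ v with hc
  have h0 : 0 ≤ (v - Sᵀ *ᵥ c) ⬝ᵥ (v - Sᵀ *ᵥ c) :=
    Finset.sum_nonneg fun _ _ => mul_self_nonneg _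
  have h1 : v ⬝ᵥ (Sᵀ *ᵥ c) = c ⬝ᵥ c := by
    rw [Matrix.mulVec_transpose, dotProduct_comm, ← Matrix.dotProduct_mulVec]
  have h2 : (Sᵀ *ᵥ c) ⬝ᵥ (Sᵀ *ᵥ c) ≤ c ⬝ᵥ c := by
    have : (Sᵀ *ᵥ c) ⬝ᵥ (Sᵀ *ᵥ c) = c ⬝ᵥ ((S * Sᵀ) *ᵥ c) := by
      rw [← Matrix.mulVec_mulVec, Matrix.dotProduct_mulVec c S, Matrix.mulVec_transpose]
    rw [this, hS]
    refine Finset.sum_le_sum fun k _ => ?_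
    rw [Matrix.mulVec_diagonal]
    nlinarith [mul_self_nonneg (c k), he k]
  have h3 : (Sᵀ *ᵥ c) ⬝ᵥ v = c ⬝ᵥ c := by rw [dotProduct_comm, h1]
  simp only [dotProduct_sub, sub_dotProduct, h1, h3] at h0
  linarith

/-- Polar-type factorisation: rows that are orthogonal with norms `a k` are `a k` times rows that
are orthogonal with norm at most one. -/
theorem exists_eq_mul_diagonal_mul {m : ℕ} {J : Type*} [Fintype J] {A : Matrix (Fin m) J ℝ}
    {U : Matrix (Fin m) (Fin m) ℝ} {a : Fin m → ℝ} (hU : U * Uᵀ = 1)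
    (hA : Uᵀ * (A * Aᵀ) * U = Matrix.diagonal fun k => a k ^ 2) :
    ∃ (R : Matrix (Fin m) J ℝ) (e : Fin m → ℝ), R * Rᵀ = Matrix.diagonal e ∧ (∀ k, e k ≤ 1) ∧
      A = U * Matrix.diagonal a * R := by
  have hC : (Uᵀ * A) * (Uᵀ * A)ᵀ = Matrix.diagonal fun k => a k ^ 2 := by
    rw [← hA]; simp [Matrix.mul_assoc]
  refine ⟨Matrix.diagonal (fun k => (a k)⁻¹) * (Uᵀ * A), fun k => (a k)⁻¹ * a k ^ 2 * (a k)⁻¹,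
    ?_, fun k => ?_, ?_⟩
  · rw [Matrix.transpose_mul, Matrix.diagonal_transpose, Matrix.mul_assoc,
      ← Matrix.mul_assoc (Uᵀ * A), hC]
    simp [Matrix.diagonal_mul_diagonal, mul_assoc]
  · by_cases h : a k = 0
    · simp [h]
    · field_simp; exact le_refl _
  · have : Matrix.diagonal a * (Matrix.diagonal (fun k => (a k)⁻¹) * (Uᵀ * A)) = Uᵀ * A := by
      rw [← Matrix.mul_assoc, Matrix.diagonal_mul_diagonal]
      ext k j
      rw [Matrix.diagonal_mul]
      by_cases h : a k = 0
      · have hk : (Uᵀ * A) k = 0 := by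
          have := congrFun (congrFun hC k) k
          rw [Matrix.diagonal_apply_eq, h, Matrix.mul_apply', zero_pow two_ne_zero] at this
          exact dotProduct_self_eq_zero.mp this
        rw [hk]; simp
      · rw [mul_inv_cancel₀ h, one_mul]
    rw [Matrix.mul_assoc, this, ← Matrix.mul_assoc, hU, Matrix.one_mul]

theorem sum_sq_row_eq_one {ι : Type*} [Fintype ι] [DecidableEq ι] {O : Matrix ι ι ℝ}
    (hO : O * Oᵀ = 1) (k : ι) : ∑ l, O k l ^ 2 = 1 := by
  have := congrFun (congrFun hO k) k
  simpa [Matrix.mul_apply, sq] using this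

theorem sum_sq_row_mul_transpose_le_one {ι J : Type*} [Fintype ι] [DecidableEq ι] [Fintype J]
    {R S : Matrix ι J ℝ} {e f : ι → ℝ} (hR : R * Rᵀ = Matrix.diagonal e)
    (hS : S * Sᵀ = Matrix.diagonal f) (he : ∀ k, e k ≤ 1) (hf : ∀ k, f k ≤ 1) (k : ι) :
    ∑ l, (R * Sᵀ) k l ^ 2 ≤ 1 := by
  have h1 := dotProduct_mulVec_self_le hS hf (R k)
  have h2 : R k ⬝ᵥ R k = e k := by
    have := congrFun (congrFun hR k) k
    simpa [Matrix.mul_apply'] using this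
  have h3 : ∀ l, (R * Sᵀ) k l = (S *ᵥ R k) l := fun l => by
    simp [Matrix.mul_apply, Matrix.mulVec, dotProduct, mul_comm]
  simp only [h3, sq]
  exact h1.trans (h2 ▸ he k)

/-- Von Neumann's trace inequality. -/
theorem trace_mul_transpose_le {m : ℕ} {J : Type*} [Fintype J] {A B : Matrix (Fin m) J ℝ}
    {U V : Matrix (Fin m) (Fin m) ℝ} {a b : Fin m → ℝ} (hU : U * Uᵀ = 1) (hV : V * Vᵀ = 1)
    (hA : Uᵀ * (A * Aᵀ) * U = Matrix.diagonal fun k => a k ^ 2)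
    (hB : Vᵀ * (B * Bᵀ) * V = Matrix.diagonal fun k => b k ^ 2)
    (ha : Antitone a) (hb : Antitone b) (ha0 : ∀ k, 0 ≤ a k) (hb0 : ∀ k, 0 ≤ b k) :
    (A * Bᵀ).trace ≤ ∑ k, a k * b k := by
  obtain ⟨R, e, hR, he, rfl⟩ := exists_eq_mul_diagonal_mul hU hA
  obtain ⟨S, f, hS, hf, rfl⟩ := exists_eq_mul_diagonal_mul hV hB
  set O := Uᵀ * V with hO
  set G := R * Sᵀ with hG
  have hUU : Uᵀ * U = 1 := mul_eq_one_comm.mp hU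
  have hVV : Vᵀ * V = 1 := mul_eq_one_comm.mp hV
  have hOO : O * Oᵀ = 1 := by
    rw [hO, Matrix.transpose_mul, Matrix.transpose_transpose, Matrix.mul_assoc,
      ← Matrix.mul_assoc V, hV, Matrix.one_mul, hUU]
  have hOO' : Oᵀ * Oᵀᵀ = 1 := by rw [Matrix.transpose_transpose]; exact mul_eq_one_comm.mp hOO
  have htr : ((U * Matrix.diagonal a * R) * (V * Matrix.diagonal b * S)ᵀ).trace
      = ∑ k, ∑ l, a k * b l * (G k l * O k l) := by
    have h1 : (U * Matrix.diagonal a * R) * (V * Matrix.diagonal b * S)ᵀ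
        = U * (Matrix.diagonal a * G * Matrix.diagonal b * Vᵀ) := by
      simp [hG, Matrix.mul_assoc]
    rw [h1, Matrix.trace_mul_comm, Matrix.mul_assoc _ Vᵀ,
      show Vᵀ * U = Oᵀ by simp [hO]]
    refine Finset.sum_congr rfl fun k _ => ?_
    rw [Matrix.diag_apply, Matrix.mul_apply]
    refine Finset.sum_congr rfl fun l _ => ?_
    rw [Matrix.mul_diagonal, Matrix.diagonal_mul, Matrix.transpose_apply]
    ring
  rw [htr]
  refine le_trans (Finset.sum_le_sum fun k _ => Finset.sum_le_sum fun l _ => ?_)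
    (sum_mul_mul_le_of_substochastic ha hb ha0 hb0
      (M := Matrix.of fun k l => (G k l ^ 2 + O k l ^ 2) / 2) ?_ ?_ ?_)
  · refine mul_le_mul_of_nonneg_left ?_ (mul_nonneg (ha0 k) (hb0 l))
    simp only [Matrix.of_apply]
    nlinarith [sq_nonneg (G k l - O k l)]
  · intro k l
    simp only [Matrix.of_apply]
    positivity
  · intro k
    have h1 := sum_sq_row_eq_one hOO k
    have h2 := sum_sq_row_mul_transpose_le_one hR hS he hf k
    simp only [Matrix.of_apply, ← Finset.sum_div, Finset.sum_add_distrib]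
    linarith
  · intro l
    have h1 := sum_sq_row_eq_one hOO' l
    have h2 := sum_sq_row_mul_transpose_le_one hS hR hf he l
    have h3 : S * Rᵀ = Gᵀ := by simp [hG]
    simp only [h3, Matrix.transpose_apply] at h1 h2
    simp only [Matrix.of_apply, ← Finset.sum_div, Finset.sum_add_distrib]
    linarith

/-- A matrix whose trace is maximal under left multiplication by orthogonal matrices is
symmetric. -/
theorem isSymm_of_trace_orthogonal_mul_le {ι : Type*} [Fintype ι] [DecidableEq ι]
    {S : Matrix ι ι ℝ} (h : ∀ U : Matrix ι ι ℝ, U * Uᵀ = 1 → (U * S).trace ≤ S.trace) :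
    S.IsSymm := by
  ext i j
  rw [Matrix.transpose_apply]
  by_cases hij : i = j
  · rw [hij]
  have hji : j ≠ i := fun h => hij h.symm
  set K : Matrix ι ι ℝ := Matrix.single i j 1 - Matrix.single j i 1 with hK
  have hKt : Kᵀ = -K := by simp [hK, Matrix.transpose_single]
  have hK2 : K * K = -(Matrix.single i i 1 + Matrix.single j j 1) := by
    simp only [hK, sub_mul, mul_sub, Matrix.single_mul_single_same,
      Matrix.single_mul_single_of_ne _ _ _ _ hij, Matrix.single_mul_single_of_ne _ _ _ _ hji]
    simp only [mul_one]; abel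
  have hK3 : K * K * K = -K := by
    rw [hK2]
    simp only [hK, neg_mul, add_mul, mul_sub, Matrix.single_mul_single_same,
      Matrix.single_mul_single_of_ne _ _ _ _ hij, Matrix.single_mul_single_of_ne _ _ _ _ hji]
    simp only [mul_one]; abel
  have hK4 : K * K * (K * K) = -(K * K) := by
    rw [← mul_assoc, hK3, neg_mul]
  have hrot : ∀ c s : ℝ, c ^ 2 + s ^ 2 = 1 →
      (1 + s • K + (1 - c) • (K * K)) * (1 + s • K + (1 - c) • (K * K))ᵀ = 1 := by
    intro c s hcs
    have ht : (1 + s • K + (1 - c) • (K * K))ᵀ = 1 - s • K + (1 - c) • (K * K) := by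
      simp [hKt, sub_eq_add_neg]
    have hKM : K * (K * K) = -K := by rw [← mul_assoc, hK3]
    rw [ht]
    simp only [add_mul, mul_add, mul_sub, one_mul, mul_one, smul_mul_assoc, mul_smul_comm,
      hK4, hKM, hK3]
    match_scalars
    · ring
    · ring
    · ring
    · linear_combination -hcs
  have htr : ∀ c s : ℝ, c ^ 2 + s ^ 2 = 1 →
      s * (S j i - S i j) + (c - 1) * (S i i + S j j) ≤ 0 := by
    intro c s hcs
    have := h _ (hrot c s hcs)
    rw [hK2] at this
    simp only [hK, add_mul, one_mul, Matrix.trace_add, smul_mul_assoc, Matrix.trace_smul, sub_mul,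
      neg_mul, Matrix.trace_sub, Matrix.trace_neg, Matrix.trace_single_mul, smul_eq_mul] at this
    linarith
  set p := S i i + S j j
  set q := S j i - S i j with hq
  suffices q = 0 by linarith
  by_contra hq0
  set r := Real.sqrt (p ^ 2 + q ^ 2) with hr
  have hpos : 0 < p ^ 2 + q ^ 2 := by positivity
  have hr0 : 0 < r := Real.sqrt_pos.mpr hpos
  have hr2 : r ^ 2 = p ^ 2 + q ^ 2 := Real.sq_sqrt hpos.le
  have h1 := htr (p / r) (q / r) (by field_simp; linarith)
  have h2 : q / r * q + (p / r - 1) * p = r - p := by field_simp; linarith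
  have hq2 : 0 < q ^ 2 := by positivity
  nlinarith

theorem singularValues_nonneg {m : ℕ} {J : Type*} [Fintype J] (A : Matrix (Fin m) J ℝ)
    (k : Fin m) : 0 ≤ singularValues A k := Real.sqrt_nonneg _

theorem singularValues_antitone {m : ℕ} {J : Type*} [Fintype J] (A : Matrix (Fin m) J ℝ) :
    Antitone (singularValues A) := fun _ _ hkl =>
  Real.sqrt_le_sqrt (Tuple.monotone_sort _ (Fin.rev_le_rev.mpr hkl))

/-- The Gram matrix of the rows of `A` is orthogonally diagonalised with the squared singular
values on the diagonal. -/
theorem exists_diagonalization_gram {m : ℕ} {J : Type*} [Fintype J] (A : Matrix (Fin m) J ℝ) :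
    ∃ U : Matrix (Fin m) (Fin m) ℝ, U * Uᵀ = 1 ∧
      Uᵀ * (A * Aᵀ) * U = Matrix.diagonal fun k => singularValues A k ^ 2 := by
  set hH := gram_isHermitian A
  set τ : Fin m ≃ Fin m := Fin.revPerm.trans (Tuple.sort hH.eigenvalues) with hτ
  set E : Matrix (Fin m) (Fin m) ℝ := hH.eigenvectorUnitary.1 with hE
  have hEt : star E = Eᵀ := Matrix.conjTranspose_eq_transpose_of_trivial E
  have hEE : Eᵀ * E = 1 := by
    rw [← hEt]; exact Unitary.coe_star_mul_self hH.eigenvectorUnitary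
  have hdiag : Eᵀ * (A * Aᵀ) * E = Matrix.diagonal hH.eigenvalues := by
    have := hH.conjStarAlgAut_star_eigenvectorUnitary
    rw [Unitary.conjStarAlgAut_star_apply] at this
    rw [← hEt]
    exact this
  have hpsd : ∀ k, 0 ≤ hH.eigenvalues k := by
    have h : (A * Aᵀ).PosSemidef := by
      simpa using Matrix.posSemidef_self_mul_conjTranspose A
    exact h.eigenvalues_nonneg
  have hcomp : ∀ k, singularValues A k ^ 2 = hH.eigenvalues (τ k) := fun k =>
    Real.sq_sqrt (hpsd (τ k))
  refine ⟨E.submatrix id τ, mul_eq_one_comm.mp ?_, ?_⟩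
  · rw [Matrix.transpose_submatrix, ← Matrix.submatrix_mul _ _ _ _ _ Function.bijective_id, hEE]
    simp
  · rw [Matrix.transpose_submatrix,
      show Eᵀ.submatrix τ id * (A * Aᵀ) * E.submatrix id τ
        = (Eᵀ * (A * Aᵀ) * E).submatrix τ τ by rfl, hdiag]
    ext k l
    simp [Matrix.diagonal_apply, hcomp]

/-- Two matrices attaining equality in von Neumann's trace inequality have symmetric
cross-products on both sides. -/
theorem isSymm_of_trace_eq_sum_singularValues {m : ℕ} {J : Type*} [Fintype J] [DecidableEq J]
    {A B : Matrix (Fin m) J ℝ}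
    (h : (A * Bᵀ).trace = ∑ k, singularValues A k * singularValues B k) :
    (A * Bᵀ).IsSymm ∧ (Bᵀ * A).IsSymm := by
  obtain ⟨U, hU, hA⟩ := exists_diagonalization_gram A
  obtain ⟨V, hV, hB⟩ := exists_diagonalization_gram B
  constructor
  · refine isSymm_of_trace_orthogonal_mul_le fun G hG => ?_
    have hG' : Gᵀ * G = 1 := mul_eq_one_comm.mp hG
    rw [h, ← Matrix.mul_assoc]
    refine trace_mul_transpose_le (U := G * U) (V := V) ?_ hV ?_ hB (singularValues_antitone A)
      (singularValues_antitone B) (singularValues_nonneg A) (singularValues_nonneg B)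
    · rw [Matrix.transpose_mul, Matrix.mul_assoc, ← Matrix.mul_assoc U, hU, Matrix.one_mul, hG]
    · rw [← hA, Matrix.transpose_mul, Matrix.transpose_mul]
      calc Uᵀ * Gᵀ * (G * A * (Aᵀ * Gᵀ)) * (G * U)
          = Uᵀ * ((Gᵀ * G) * (A * (Aᵀ * ((Gᵀ * G) * U)))) := by simp only [Matrix.mul_assoc]
        _ = Uᵀ * (A * Aᵀ) * U := by
          rw [hG', Matrix.one_mul, Matrix.one_mul]; simp only [Matrix.mul_assoc]
  · refine isSymm_of_trace_orthogonal_mul_le fun G hG => ?_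
    have hG' : Gᵀ * G = 1 := mul_eq_one_comm.mp hG
    have htr : (G * (Bᵀ * A)).trace = (A * (B * Gᵀ)ᵀ).trace := by
      rw [← Matrix.mul_assoc, Matrix.trace_mul_comm, Matrix.transpose_mul,
        Matrix.transpose_transpose]
    rw [Matrix.trace_mul_comm Bᵀ A, h, htr]
    refine trace_mul_transpose_le hU hV hA ?_ (singularValues_antitone A)
      (singularValues_antitone B) (singularValues_nonneg A) (singularValues_nonneg B)
    rw [← hB, Matrix.transpose_mul, Matrix.transpose_transpose, Matrix.mul_assoc B,
      ← Matrix.mul_assoc Gᵀ, hG', Matrix.one_mul]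

/-- Pairwise commuting real symmetric matrices have a common orthonormal eigenbasis. -/
theorem exists_orthogonal_common_eigenvectors {m : ℕ} {κ : Type*}
    {T : κ → Matrix (Fin m) (Fin m) ℝ} (hT : ∀ t, (T t).IsSymm)
    (hC : ∀ s t, Commute (T s) (T t)) :
    ∃ W : Matrix (Fin m) (Fin m) ℝ, W * Wᵀ = 1 ∧
      ∀ t k, ∃ c : ℝ, T t *ᵥ W.col k = c • W.col k := by
  classical
  set F : κ → EuclideanSpace ℝ (Fin m) →ₗ[ℝ] EuclideanSpace ℝ (Fin m) :=
    fun t => Matrix.toEuclideanLin (T t) with hF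
  have hsymm : ∀ t, (F t).IsSymmetric := fun t =>
    Matrix.isSymmetric_toEuclideanLin_iff.mpr
      (by rw [Matrix.IsHermitian, Matrix.conjTranspose_eq_transpose_of_trivial]; exact hT t)
  have hcomm : Pairwise (Function.onFun Commute F) := fun s t _ => by
    change F s * F t = F t * F s
    ext v : 1
    have := (hC s t).eq
    simp only [hF, Module.End.mul_apply, Matrix.toLpLin_apply, Matrix.mulVec_mulVec, this]
  have hdirect := LinearMap.IsSymmetric.directSum_isInternal_of_pairwise_commute hsymm hcomm
  have horth := LinearMap.IsSymmetric.orthogonalFamily_iInf_eigenspaces hsymm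
  set b := hdirect.collectedBasis fun α => (stdOrthonormalBasis ℝ _).toBasis with hb
  have hbo : Orthonormal ℝ b := by
    refine hdirect.collectedBasis_orthonormal horth fun α => ?_
    simp
  have : Fintype (Σ α : κ → ℝ, Fin (Module.finrank ℝ
      (⨅ t, Module.End.eigenspace (F t) (α t) : Submodule ℝ (EuclideanSpace ℝ (Fin m))))) :=
    FiniteDimensional.fintypeBasisIndex b
  have hcard := Module.finrank_eq_card_basis b
  rw [finrank_euclideanSpace_fin] at hcard
  set σ := Fintype.equivFinOfCardEq hcard.symm with hσ
  set o := (b.toOrthonormalBasis hbo).reindex σ with ho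
  have hoM : (Matrix.of fun i k => o k i) = (EuclideanSpace.basisFun (Fin m) ℝ).toBasis.toMatrix o.toBasis := by
    ext i k; rfl
  refine ⟨Matrix.of fun i k => o k i, ?_, fun t k => ?_⟩
  · rw [hoM]
    have := ((EuclideanSpace.basisFun (Fin m) ℝ).toMatrix_orthonormalBasis_mem_unitary o).2
    rwa [Matrix.star_eq_conjTranspose, Matrix.conjTranspose_eq_transpose_of_trivial] at this
  · refine ⟨(σ.symm k).1 t, ?_⟩
    have hmem := hdirect.collectedBasis_mem
      (fun α => (stdOrthonormalBasis ℝ _).toBasis) (σ.symm k)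
    have h2 := Module.End.mem_eigenspace_iff.mp ((Submodule.mem_iInf _).mp hmem t)
    have hok : o k = b (σ.symm k) := by simp [ho]
    rw [← hb, ← hok] at h2
    have h3 := congrArg (WithLp.ofLp) h2
    exact h3

/-- Proportionality of two vectors, where `none` stands for an infinite ratio. -/
def HasRatio {J : Type*} (x y : J → ℝ) : Option ℝ → Prop
  | some r => x = r • y
  | none => y = 0

theorem exists_hasRatio {J : Type*} [Fintype J] {x y : J → ℝ}
    (h : (x ⬝ᵥ y) ^ 2 = (x ⬝ᵥ x) * (y ⬝ᵥ y)) : ∃ c, HasRatio x y c := by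
  by_cases hy : y = 0
  · exact ⟨none, hy⟩
  have hq : y ⬝ᵥ y ≠ 0 := fun h => hy (dotProduct_self_eq_zero.mp h)
  refine ⟨some ((x ⬝ᵥ y) / (y ⬝ᵥ y)), sub_eq_zero.mp (dotProduct_self_eq_zero.mp ?_)⟩
  simp only [dotProduct_sub, sub_dotProduct, smul_dotProduct, dotProduct_smul, smul_eq_mul,
    dotProduct_comm y x]
  field_simp
  linarith

/-- In the equality case of von Neumann's trace inequality, the rows of both matrices become
proportional after a common orthogonal change of basis. -/
theorem exists_orthogonal_hasRatio {m : ℕ} {J : Type*} [Fintype J] [DecidableEq J]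
    {A B : Matrix (Fin m) J ℝ}
    (h : (A * Bᵀ).trace = ∑ k, singularValues A k * singularValues B k) :
    ∃ W : Matrix (Fin m) (Fin m) ℝ, W * Wᵀ = 1 ∧
      ∀ k, ∃ c, HasRatio (Aᵀ *ᵥ W.col k) (Bᵀ *ᵥ W.col k) c := by
  obtain ⟨h1, h2⟩ := isSymm_of_trace_eq_sum_singularValues h
  have h1' : B * Aᵀ = A * Bᵀ := by simpa [Matrix.IsSymm] using h1
  have h2' : Aᵀ * B = Bᵀ * A := by simpa [Matrix.IsSymm] using h2
  have hPQ : (A * Aᵀ) * (B * Bᵀ) = (A * Bᵀ) * (A * Bᵀ) := by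
    rw [Matrix.mul_assoc, ← Matrix.mul_assoc Aᵀ, h2']; simp only [Matrix.mul_assoc]
  have hQP : (B * Bᵀ) * (A * Aᵀ) = (A * Bᵀ) * (A * Bᵀ) := by
    rw [Matrix.mul_assoc, ← Matrix.mul_assoc Bᵀ, ← h2', ← h1']; simp only [Matrix.mul_assoc]
  have hPS : (A * Aᵀ) * (A * Bᵀ) = (A * Bᵀ) * (A * Aᵀ) := by
    rw [← h1', Matrix.mul_assoc, ← Matrix.mul_assoc Aᵀ, h2', ← Matrix.mul_assoc A,
      ← Matrix.mul_assoc A, ← h1']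
    simp only [Matrix.mul_assoc]
  have hQS : (B * Bᵀ) * (A * Bᵀ) = (A * Bᵀ) * (B * Bᵀ) := by
    rw [Matrix.mul_assoc, ← Matrix.mul_assoc Bᵀ, ← h2', ← Matrix.mul_assoc B, ← Matrix.mul_assoc B,
      h1']
    simp only [Matrix.mul_assoc]
  obtain ⟨W, hW, hdiag⟩ := exists_orthogonal_common_eigenvectors
    (T := ![A * Aᵀ, B * Bᵀ, A * Bᵀ])
    (by intro t; fin_cases t <;> simp [Matrix.IsSymm, h1'])
    (by
      intro s t
      fin_cases s <;> fin_cases t <;>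
        simp [Commute, SemiconjBy, hPQ, hQP, hPS, hQS])
  refine ⟨W, hW, fun k => exists_hasRatio ?_⟩
  set w := W.col k with hw
  have hww : w ⬝ᵥ w = 1 := by
    have hW' : Wᵀ * W = 1 := mul_eq_one_comm.mp hW
    have := congrFun (congrFun hW' k) k
    simpa [Matrix.mul_apply, hw, dotProduct] using this
  have hdot : ∀ M N : Matrix (Fin m) J ℝ,
      (Mᵀ *ᵥ w) ⬝ᵥ (Nᵀ *ᵥ w) = w ⬝ᵥ ((M * Nᵀ) *ᵥ w) := fun M N => by
    rw [← Matrix.mulVec_mulVec, Matrix.dotProduct_mulVec w M, Matrix.mulVec_transpose M]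
  obtain ⟨p, hp⟩ := hdiag 0 k
  obtain ⟨q, hq⟩ := hdiag 1 k
  obtain ⟨s, hs⟩ := hdiag 2 k
  simp only [Matrix.cons_val, ← hw] at hp hq hs
  have hsq : p * q = s ^ 2 := by
    have h3 : ((A * Aᵀ) * (B * Bᵀ)) *ᵥ w = ((A * Bᵀ) * (A * Bᵀ)) *ᵥ w := by rw [hPQ]
    rw [← Matrix.mulVec_mulVec w (A * Aᵀ), ← Matrix.mulVec_mulVec w (A * Bᵀ), hq, hs, Matrix.mulVec_smul,
      Matrix.mulVec_smul, hp, hs] at h3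
    have h4 := congrArg (w ⬝ᵥ ·) h3
    simp only [dotProduct_smul, smul_eq_mul, hww] at h4
    linarith
  rw [hdot, hdot, hdot, hp, hq, hs]
  simp only [dotProduct_smul, hww, smul_eq_mul]
  linarith

/-- The multi-index obtained from `j` on the modes other than `d` by inserting `k` in mode `d`. -/
def insertMode (d : Fin D) (k : Fin (n d)) (j : ∀ d' : {d' : Fin D // d' ≠ d}, Fin (n d')) :
    ∀ d', Fin (n d') :=
  fun d' => if h : d' = d then Fin.cast (congrArg n h.symm) k else j ⟨d', h⟩

theorem insertMode_self (d : Fin D) (k : Fin (n d))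
    (j : ∀ d' : {d' : Fin D // d' ≠ d}, Fin (n d')) : insertMode d k j d = k := by
  simp [insertMode]

theorem insertMode_of_ne (d : Fin D) (k : Fin (n d))
    (j : ∀ d' : {d' : Fin D // d' ≠ d}, Fin (n d')) (d' : {d' : Fin D // d' ≠ d}) :
    insertMode d k j d' = j d' := by
  simp [insertMode, d'.2]

theorem sum_eq_sum_insertMode (d : Fin D) (f : (∀ d', Fin (n d')) → ℝ) :
    ∑ i, f i = ∑ j, ∑ k, f (insertMode d k j) := by
  rw [Finset.sum_comm, ← Fintype.sum_prod_type' (f := fun k j => f (insertMode d k j))]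
  refine Fintype.sum_equiv (Equiv.piSplitAt d fun d' => Fin (n d')) _ _ fun i => congrArg f ?_
  ext d'
  by_cases h : d' = d
  · subst h
    simp [insertMode]
  · simp [insertMode, h]

theorem tinner_eq_trace (X Y : (∀ d, Fin (n d)) → ℝ) (d : Fin D) :
    tinner X Y = (matricize X d * (matricize Y d)ᵀ).trace := by
  rw [tinner, sum_eq_sum_insertMode d, Finset.sum_comm]
  rfl

theorem tuckerMul_transpose_eq_zero {Z : (∀ d, Fin (n d)) → ℝ}
    {W : ∀ d, Matrix (Fin (n d)) (Fin (n d)) ℝ} {i : ∀ d, Fin (n d)} {d : Fin D}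
    (h : (matricize Z d)ᵀ *ᵥ (W d).col (i d) = 0) : tuckerMul Z (fun d => (W d)ᵀ) i = 0 := by
  rw [tuckerMul, sum_eq_sum_insertMode d]
  refine Finset.sum_eq_zero fun j _ => ?_
  have hj : ∑ k, Z (insertMode d k j) * W d k (i d) = 0 := congrFun h j
  have hprod : ∀ k, ∏ d', (W d')ᵀ (i d') (insertMode d k j d')
      = W d k (i d) * ∏ d' : {d' // d' ≠ d}, W d' (j d') (i d') := fun k => by
    rw [Fintype.prod_eq_mul_prod_subtype_ne _ d]
    simp only [Matrix.transpose_apply, insertMode_self, insertMode_of_ne]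
  calc ∑ k, (∏ d', (W d')ᵀ (i d') (insertMode d k j d')) * Z (insertMode d k j)
      = (∏ d' : {d' // d' ≠ d}, W d' (j d') (i d')) * ∑ k, Z (insertMode d k j) * W d k (i d) := by
        rw [Finset.mul_sum]
        exact Finset.sum_congr rfl fun k _ => by rw [hprod]; ring
    _ = 0 := by rw [hj, mul_zero]

theorem tuckerMul_tuckerMul_transpose (X : (∀ d, Fin (n d)) → ℝ)
    {W : ∀ d, Matrix (Fin (n d)) (Fin (n d)) ℝ} (hW : ∀ d, W d * (W d)ᵀ = 1) :
    tuckerMul (tuckerMul X fun d => (W d)ᵀ) W = X := by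
  funext i
  have hdelta : ∀ k : ∀ d, Fin (n d),
      ∑ j : ∀ d, Fin (n d), (∏ d, W d (i d) (j d)) * ∏ d, (W d)ᵀ (j d) (k d)
        = if i = k then 1 else 0 := fun k => by
    simp only [← Finset.prod_mul_distrib]
    rw [← Fintype.prod_sum (f := fun d l => W d (i d) l * (W d)ᵀ l (k d))]
    simp only [← Matrix.mul_apply, hW, Matrix.one_apply, Finset.prod_ite_zero]
    simp [funext_iff]
  simp only [tuckerMul, Finset.mul_sum]
  rw [Finset.sum_comm]
  simp only [← mul_assoc, ← Finset.sum_mul, hdelta]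
  simp

theorem tuckerMul_sub_smul (X Y : (∀ d, Fin (n d)) → ℝ)
    (U : ∀ d, Matrix (Fin (n d)) (Fin (n d)) ℝ) (r : ℝ) :
    tuckerMul (X - r • Y) U = tuckerMul X U - r • tuckerMul Y U := by
  funext i
  simp only [tuckerMul, Pi.sub_apply, Pi.smul_apply, smul_eq_mul, mul_sub, Finset.sum_sub_distrib,
    Finset.mul_sum]
  congr 1
  exact Finset.sum_congr rfl fun j _ => by ring

theorem matricize_sub_smul (X Y : (∀ d, Fin (n d)) → ℝ) (d : Fin D) (r : ℝ) :
    matricize (X - r • Y) d = matricize X d - r • matricize Y d := rfl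

/-- Entrywise proportionality, with `none` standing for an infinite ratio. -/
def EntryRatio (x y : ℝ) : Option ℝ → Prop
  | some r => x = r * y
  | none => y = 0

theorem EntryRatio.eq_zero_of_ne {x y : ℝ} {c c' : Option ℝ} (h : EntryRatio x y c)
    (h' : EntryRatio x y c') (hne : c ≠ c') : x = 0 ∧ y = 0 := by
  cases c with
  | none =>
    cases c' with
    | none => exact absurd rfl hne
    | some r' =>
      have hy : y = 0 := h
      have hx : x = r' * y := h'
      simp [hx, hy]
  | some r =>
    have hx : x = r * y := h
    cases c' with
    | none =>
      have hy : y = 0 := h'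
      simp [hx, hy]
    | some r' =>
      have hx' : x = r' * y := h'
      have hr : r - r' ≠ 0 := sub_ne_zero.mpr fun e => hne (by rw [e])
      have hy : y = 0 := by
        have : (r - r') * y = 0 := by linarith
        exact (mul_eq_zero.mp this).resolve_left hr
      simp [hx, hy]

theorem entryRatio_tuckerMul_transpose {X Y : (∀ d, Fin (n d)) → ℝ}
    {W : ∀ d, Matrix (Fin (n d)) (Fin (n d)) ℝ} {i : ∀ d, Fin (n d)} {d : Fin D} {c : Option ℝ}
    (h : HasRatio ((matricize X d)ᵀ *ᵥ (W d).col (i d)) ((matricize Y d)ᵀ *ᵥ (W d).col (i d)) c) :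
    EntryRatio (tuckerMul X (fun d => (W d)ᵀ) i) (tuckerMul Y (fun d => (W d)ᵀ) i) c := by
  cases c with
  | none => exact tuckerMul_transpose_eq_zero h
  | some r =>
    have h' : (matricize (X - r • Y) d)ᵀ *ᵥ (W d).col (i d) = 0 := by
      rw [matricize_sub_smul, Matrix.transpose_sub, Matrix.transpose_smul, Matrix.sub_mulVec,
        Matrix.smul_mulVec, sub_eq_zero]
      exact h
    have := tuckerMul_transpose_eq_zero h'
    rw [tuckerMul_sub_smul] at this
    exact sub_eq_zero.mp this

/-- necessity part of the equality case of von Neumann's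
inequality for tensors. -/
theorem tensor_equality_necessity (D : ℕ) (hD : 1 ≤ D) (n : Fin D → ℕ)
    (X Y : (∀ d, Fin (n d)) → ℝ)
    (heq : ∀ d : Fin D, tinner X Y = ∑ k : Fin (n d), modeSV X d k * modeSV Y d k) :
    ∃ (W : ∀ d, Matrix (Fin (n d)) (Fin (n d)) ℝ) (L : ℕ)
      (β : ∀ d, Fin (n d) → Option (Fin L))
      (DX DY : (∀ d, Fin (n d)) → ℝ) (ρ : Fin L → ℝ),
      (∀ d, W d * (W d)ᵀ = 1) ∧
      X = tuckerMul DX W ∧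
      Y = tuckerMul DY W ∧
      (∀ i : ∀ d, Fin (n d), (¬ ∃ l : Fin L, ∀ d, β d (i d) = some l) → DX i = 0) ∧
      (∀ i : ∀ d, Fin (n d), (¬ ∃ l : Fin L, ∀ d, β d (i d) = some l) → DY i = 0) ∧
      (∀ l : Fin L,
        (∀ i : ∀ d, Fin (n d), (∀ d, β d (i d) = some l) → DX i = ρ l * DY i) ∨
        (∀ i : ∀ d, Fin (n d), (∀ d, β d (i d) = some l) → DY i = ρ l * DX i)) := by
  classical
  have hmode : ∀ d, ∃ W : Matrix (Fin (n d)) (Fin (n d)) ℝ, W * Wᵀ = 1 ∧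
      ∀ k, ∃ c, HasRatio ((matricize X d)ᵀ *ᵥ W.col k) ((matricize Y d)ᵀ *ᵥ W.col k) c := fun d =>
    exists_orthogonal_hasRatio ((tinner_eq_trace X Y d).symm.trans (heq d))
  choose W hW c hc using hmode
  set DX := tuckerMul X fun d => (W d)ᵀ with hDX
  set DY := tuckerMul Y fun d => (W d)ᵀ with hDY
  have hratio : ∀ i d, EntryRatio (DX i) (DY i) (c d (i d)) := fun i d =>
    entryRatio_tuckerMul_transpose (hc d (i d))
  let C := Set.range fun p : Σ d, Fin (n d) => c p.1 p.2
  have : Fintype C := Fintype.ofFinite C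
  let σ : C ≃ Fin (Fintype.card C) := Fintype.equivFin C
  let β : ∀ d, Fin (n d) → Option (Fin (Fintype.card C)) :=
    fun d k => some (σ ⟨c d k, ⟨d, k⟩, rfl⟩)
  have hβ : ∀ d k l, β d k = some l ↔ c d k = σ.symm l := fun d k l => by
    simp only [β, Option.some.injEq]
    rw [← Equiv.eq_symm_apply, Subtype.ext_iff]
  let d₀ : Fin D := ⟨0, hD⟩
  have hoff : ∀ i : ∀ d, Fin (n d), (¬ ∃ l, ∀ d, β d (i d) = some l) → DX i = 0 ∧ DY i = 0 := by
    intro i hi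
    push Not at hi
    obtain ⟨d, hd⟩ := hi (σ ⟨c d₀ (i d₀), ⟨d₀, i d₀⟩, rfl⟩)
    rw [Ne, hβ, Equiv.symm_apply_apply] at hd
    exact (hratio i d).eq_zero_of_ne (hratio i d₀) hd
  refine ⟨W, Fintype.card C, β, DX, DY, fun l => (σ.symm l : Option ℝ).getD 0, hW,
    (tuckerMul_tuckerMul_transpose X hW).symm, (tuckerMul_tuckerMul_transpose Y hW).symm,
    fun i hi => (hoff i hi).1, fun i hi => (hoff i hi).2, fun l => ?_⟩
  have hblock : ∀ i : ∀ d, Fin (n d), (∀ d, β d (i d) = some l) →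
      EntryRatio (DX i) (DY i) (σ.symm l) := fun i hi => (hβ _ _ _).mp (hi d₀) ▸ hratio i d₀
  cases hl : (σ.symm l : Option ℝ) with
  | none =>
    refine Or.inr fun i hi => ?_
    have := hblock i hi
    rw [hl] at this
    have hy : DY i = 0 := this
    simp [hy, hl]
  | some r =>
    refine Or.inl fun i hi => ?_
    have := hblock i hi
    simp only [hl]
    rw [hl] at this
    exact this
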